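/- Let a>1, b>1, c>0, r>0, s>0 be integers with gcd(ra, sb)=1. If the equation (-1)^u·r·a^x + (-1)^v·s·b^y = c has three pairwise distinct solutions (x₁,y₁), (x₂,y₂), (x₃,y₃) in positive integers x,y with u,v ∈ {0,1}, then max(x₁, y₁, x₂, y₂, x₃, y₃) ≥ max(r, s, a, b). -/

import Mathlib

/-- A solution of equation (1): `(-1)^u * r * a^x + (-1)^v * s * b^y = c`
with `x, y` positive integers and `u, v ∈ {0,1}`. -/
def IsSol (a b c r s : ℤ) (x y : ℕ) : Prop :=
  0 < x ∧ 0 < y ∧ ∃ u v : ℕ, u ≤ 1 ∧ v ≤ 1 ∧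
    (-1 : ℤ) ^ u * r * a ^ x + (-1 : ℤ) ^ v * s * b ^ y = c

/-- Two divisibilities `M ∣ b ^ d ± 1` and `M ∣ b ^ e ± 1` descend to the gcd of the exponents. -/
theorem exists_dvd_pow_gcd_sub_sign {M b ε ε' : ℤ} {d e : ℕ} (hb : IsCoprime b M)
    (hε : ε = 1 ∨ ε = -1) (hε' : ε' = 1 ∨ ε' = -1)
    (hd : M ∣ b ^ d - ε) (he : M ∣ b ^ e - ε') :
    ∃ δ : ℤ, (δ = 1 ∨ δ = -1) ∧ M ∣ b ^ (d.gcd e) - δ := by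
  induction d, e using Nat.gcd.induction generalizing ε ε' with
  | H0 n => exact ⟨ε', hε', by simpa using he⟩
  | H1 m n hm ih =>
    have h2 : ε * ε = 1 := by rcases hε with rfl | rfl <;> norm_num
    set q := n / m
    have hn : n = m * q + n % m := (Nat.div_add_mod n m).symm
    have hεq : ε ^ q * ε ^ q = 1 := by rw [← mul_pow, h2, one_pow]
    have hq : M ∣ b ^ (m * q) - ε ^ q := by
      rw [pow_mul]; exact hd.trans (sub_dvd_pow_sub_pow _ _ q)
    have key : M ∣ b ^ (m * q) * (b ^ (n % m) - ε' * ε ^ q) := by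
      have : b ^ (m * q) * (b ^ (n % m) - ε' * ε ^ q) =
          (b ^ n - ε') - ε' * ε ^ q * (b ^ (m * q) - ε ^ q) := by
        conv_rhs => rw [hn, pow_add]
        linear_combination (-ε') * hεq
      rw [this]
      exact dvd_sub he (hq.mul_left _)
    have hmod : M ∣ b ^ (n % m) - ε' * ε ^ q :=
      (IsCoprime.pow_left hb).symm.dvd_of_dvd_mul_left key
    have hsgn : ε' * ε ^ q = 1 ∨ ε' * ε ^ q = -1 := by
      rcases neg_one_pow_eq_or ℤ q with h | h <;> rcases hε with rfl | rfl <;>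
        rcases hε' with rfl | rfl <;> simp [h]
    rw [Nat.gcd_rec]
    exact ih hsgn hε hmod hd

/-- Lifting the exponent: if `X - δ = M * T` and `K` only has prime factors dividing `M` but not
`T`, then divisibility of `X ^ m - δ ^ m` by `K * M` forces `K ∣ m`. -/
theorem dvd_of_mul_dvd_pow_sub_pow {M X δ T : ℤ} {K m : ℕ} (hM : M ≠ 0)
    (hδ : δ = 1 ∨ δ = -1) (hX : X - δ = M * T)
    (hKM : ∀ p : ℕ, p.Prime → p ∣ K → (p : ℤ) ∣ M)
    (hKT : ∀ p : ℕ, p.Prime → p ∣ K → ¬ (p : ℤ) ∣ T)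
    (h2 : 2 ∣ K → 4 ∣ M) (h : (K : ℤ) * M ∣ X ^ m - δ ^ m) : K ∣ m := by
  rw [Nat.dvd_iff_prime_pow_dvd_dvd]
  intro p k hp hpk
  rcases Nat.eq_zero_or_pos k with rfl | hk
  · simp
  have hpK : p ∣ K := (dvd_pow_self p hk.ne').trans hpk
  have hpp : Prime (p : ℤ) := Nat.prime_iff_prime_int.mp hp
  have hdX : (p : ℤ) ∣ X - δ := hX ▸ (hKM p hp hpK).mul_right T
  have hnX : ¬ (p : ℤ) ∣ X := by
    intro hd
    have h1 : (p : ℤ) ∣ δ := (dvd_sub_right hd).mp hdX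
    have : IsUnit δ := Int.isUnit_iff.mpr hδ
    exact hpp.not_isUnit (isUnit_of_dvd_unit h1 this)
  have hlte : emultiplicity (p : ℤ) (X ^ m - δ ^ m) =
      emultiplicity (p : ℤ) (X - δ) + emultiplicity p m := by
    rcases hp.eq_two_or_odd' with rfl | ho
    · have h4 : (4 : ℤ) ∣ X - δ := hX ▸ (h2 hpK).mul_right T
      have := Int.two_pow_sub_pow' m h4 (by exact_mod_cast hnX)
      rw [← Int.natCast_emultiplicity]
      exact_mod_cast this
    · exact Int.emultiplicity_pow_sub_pow hp ho hdX hnX m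
  have hT : emultiplicity (p : ℤ) T = 0 := emultiplicity_eq_zero.mpr (hKT p hp hpK)
  rw [hX, emultiplicity_mul hpp, hT, add_zero] at hlte
  have hfin : FiniteMultiplicity (p : ℤ) M :=
    Int.finiteMultiplicity_iff.mpr ⟨by simpa using hp.ne_one, hM⟩
  have hdvd : (p : ℤ) ^ (multiplicity (p : ℤ) M + k) ∣ X ^ m - δ ^ m := by
    refine Dvd.dvd.trans ?_ h
    rw [add_comm, pow_add]
    exact mul_dvd_mul (by exact_mod_cast hpk) (pow_multiplicity_dvd _ _)
  rw [pow_dvd_iff_le_emultiplicity, hlte, hfin.emultiplicity_eq_multiplicity, Nat.cast_add,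
    ENat.add_le_add_iff_left (ENat.natCast_ne_top _)] at hdvd
  exact pow_dvd_iff_le_emultiplicity.mpr hdvd

/-- A power of two dividing `b ^ e ± 1` is at most `b + 1` times the `2`-part of `e`. -/
theorem two_pow_le_of_dvd_pow_sub_sign {b ε : ℤ} (hb : 1 < b) (ho : Odd b)
    (hε : ε = 1 ∨ ε = -1) {n : ℕ} (hn : Odd n) (h x : ℕ) (hx : 2 ≤ x)
    (hdvd : (2 : ℤ) ^ x ∣ b ^ (2 ^ h * n) - ε) : (2 : ℤ) ^ x ≤ (b + 1) * 2 ^ h := by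
  have hb3 : 3 ≤ b := by obtain ⟨k, rfl⟩ := ho; omega
  induction h generalizing x ε with
  | zero =>
    have hεn : ε ^ n = ε := by rcases hε with rfl | rfl <;> simp [hn.neg_one_pow]
    have h2 : (2 : ℤ) ∣ b - ε := by
      obtain ⟨k, rfl⟩ := ho
      rcases hε with rfl | rfl <;> omega
    have hm := emultiplicity_pow_sub_pow_of_prime (R := ℤ) Int.prime_two h2
      (by obtain ⟨k, rfl⟩ := ho; omega) (n := n) (by obtain ⟨k, rfl⟩ := hn; omega)
    rw [hεn] at hm
    have : (2 : ℤ) ^ x ∣ b - ε := by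
      rw [pow_dvd_iff_le_emultiplicity, ← hm, ← pow_dvd_iff_le_emultiplicity]
      simpa using hdvd
    have := Int.le_of_dvd (by rcases hε with rfl | rfl <;> omega) this
    rcases hε with rfl | rfl <;> simp <;> omega
  | succ h ih =>
    set z := b ^ (2 ^ h * n) with hz
    have hsq : b ^ (2 ^ (h + 1) * n) = z ^ 2 := by rw [hz, ← pow_mul]; ring_nf
    have hzo : Odd z := ho.pow
    rw [hsq] at hdvd
    have h4 : (4 : ℤ) ∣ z ^ 2 - ε := (pow_dvd_pow (2 : ℤ) hx).trans hdvd
    obtain ⟨w, hw⟩ := hzo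
    have hε1 : ε = 1 := by
      rcases hε with rfl | rfl
      · rfl
      · rw [hw] at h4; ring_nf at h4; omega
    subst hε1
    obtain ⟨k, rfl⟩ : ∃ k, x = k + 2 := ⟨x - 2, by omega⟩
    rcases Nat.eq_zero_or_pos k with rfl | hk
    · have : (1 : ℤ) ≤ 2 ^ (h + 1) := one_le_pow₀ (by norm_num)
      have := mul_le_mul (show (4 : ℤ) ≤ b + 1 by omega) this (by norm_num) (by omega)
      rwa [mul_one, show (4 : ℤ) = 2 ^ (0 + 2) by norm_num] at this
    have hww : (2 : ℤ) ^ k ∣ w * (w + 1) := by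
      have : z ^ 2 - 1 = 2 ^ 2 * (w * (w + 1)) := by rw [hw]; ring
      rw [this, pow_add, mul_comm] at hdvd
      exact Int.dvd_of_mul_dvd_mul_left (by norm_num) hdvd
    have hor : (2 : ℤ) ^ k ∣ w ∨ (2 : ℤ) ^ k ∣ w + 1 := by
      rcases Int.even_or_odd w with he | ho'
      · left
        have : IsCoprime ((2 : ℤ) ^ k) (w + 1) := by
          apply IsCoprime.pow_left
          obtain ⟨j, rfl⟩ := he
          exact ⟨-j, 1, by ring⟩
        exact this.dvd_of_dvd_mul_right hww
      · right
        have : IsCoprime ((2 : ℤ) ^ k) w := by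
          apply IsCoprime.pow_left
          obtain ⟨j, rfl⟩ := ho'
          exact ⟨-j, 1, by ring⟩
        exact this.dvd_of_dvd_mul_left hww
    have hnext : ∃ η : ℤ, (η = 1 ∨ η = -1) ∧ (2 : ℤ) ^ (k + 1) ∣ z - η := by
      rcases hor with h | h
      · refine ⟨1, by simp, ?_⟩
        rw [hw, pow_succ, mul_comm]
        simpa using mul_dvd_mul_left 2 h
      · refine ⟨-1, by simp, ?_⟩
        rw [hw, pow_succ, mul_comm]
        have := mul_dvd_mul_left 2 h
        rwa [show 2 * w + 1 - -1 = 2 * (w + 1) by ring]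
    obtain ⟨η, hη, hd⟩ := hnext
    have := ih hη (k + 1) (by omega) hd
    rw [show k + 2 = (k + 1) + 1 from rfl, pow_succ, pow_succ 2 h]
    linarith

theorem IsSol.swap {a b c r s : ℤ} {x y : ℕ} (h : IsSol a b c r s x y) :
    IsSol b a c s r y x := by
  obtain ⟨hx, hy, u, v, hu, hv, h⟩ := h
  exact ⟨hy, hx, v, u, hv, hu, by linarith⟩

theorem IsSol.exists_signs {a b c r s : ℤ} {x y : ℕ} (h : IsSol a b c r s x y) :
    ∃ α β : ℤ, (α = 1 ∨ α = -1) ∧ (β = 1 ∨ β = -1) ∧ α * r * a ^ x + β * s * b ^ y = c := by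
  obtain ⟨_, _, u, v, _, _, h⟩ := h
  exact ⟨_, _, neg_one_pow_eq_or ℤ u, neg_one_pow_eq_or ℤ v, h⟩

/-- Comparing two solutions with `x ≤ x'` and `y ≠ y'`. -/
theorem IsSol.exists_factor {a b c r s : ℤ} (ha : 1 < a) (hb : 1 < b) (hr : 0 < r) (hs : 0 < s)
    (hco : IsCoprime (r * a) (s * b)) {x y x' y' : ℕ} (h : IsSol a b c r s x y)
    (h' : IsSol a b c r s x' y') (hx : x ≤ x') (hy : y ≠ y') :
    ∃ ε ε' t : ℤ, (ε = 1 ∨ ε = -1) ∧ (ε' = 1 ∨ ε' = -1) ∧ 0 < t ∧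
      b ^ Nat.dist y y' - ε = r * a ^ x * t ∧
      a ^ (x' - x) - ε' = s * b ^ min y y' * t := by
  obtain ⟨α, β, hα, hβ, e⟩ := h.exists_signs
  obtain ⟨α', β', hα', hβ', e'⟩ := h'.exists_signs
  obtain ⟨n, rfl⟩ := Nat.exists_eq_add_of_le hx
  rw [Nat.add_sub_cancel_left]
  have hββ : β * β' = 1 ∨ β * β' = -1 := by
    rcases hβ with rfl | rfl <;> rcases hβ' with rfl | rfl <;> simp
  have hαα : α * α' = 1 ∨ α * α' = -1 := by
    rcases hα with rfl | rfl <;> rcases hα' with rfl | rfl <;> simp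
  have hrel : ∃ σ : ℤ, (σ = 1 ∨ σ = -1) ∧ r * a ^ x * (a ^ n - α * α') =
      σ * (s * b ^ min y y' * (b ^ Nat.dist y y' - β * β')) := by
    have hα2 : α' * α' = 1 := by rcases hα' with rfl | rfl <;> norm_num
    have hβ1 : β * β = 1 := by rcases hβ with rfl | rfl <;> norm_num
    have hβ2 : β' * β' = 1 := by rcases hβ' with rfl | rfl <;> norm_num
    rcases lt_or_gt_of_ne hy with hlt | hlt
    · obtain ⟨d, rfl⟩ := Nat.exists_eq_add_of_le hlt.le
      rw [min_eq_left hlt.le, Nat.dist_eq_sub_of_le hlt.le, Nat.add_sub_cancel_left]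
      refine ⟨-(α' * β'), ?_, ?_⟩
      · rcases hα' with rfl | rfl <;> rcases hβ' with rfl | rfl <;> simp
      · rw [pow_add, pow_add] at e'
        linear_combination α' * e' - α' * e - r * a ^ x * a ^ n * hα2 -
          s * b ^ y * α' * β * hβ2
    · obtain ⟨d, rfl⟩ := Nat.exists_eq_add_of_le hlt.le
      rw [min_eq_right hlt.le, Nat.dist_eq_sub_of_le_right hlt.le, Nat.add_sub_cancel_left]
      refine ⟨α' * β, ?_, ?_⟩
      · rcases hα' with rfl | rfl <;> rcases hβ with rfl | rfl <;> simp
      · rw [pow_add] at e e'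
        linear_combination α' * e' - α' * e - r * a ^ x * a ^ n * hα2 +
          s * b ^ y' * α' * β' * hβ1
  obtain ⟨σ, hσ, hrel⟩ := hrel
  have hd : Nat.dist y y' ≠ 0 := fun h0 => hy (Nat.eq_of_dist_eq_zero h0)
  have hB : 0 < b ^ Nat.dist y y' - β * β' := by
    have : 1 < b ^ Nat.dist y y' := one_lt_pow₀ hb hd
    rcases hββ with h | h <;> rw [h] <;> linarith
  have hA : 0 ≤ a ^ n - α * α' := by
    have : 1 ≤ a ^ n := one_le_pow₀ ha.le
    rcases hαα with h | h <;> rw [h] <;> linarith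
  have hP : 0 < r * a ^ x := by positivity
  have hQ : 0 < s * b ^ min y y' := by positivity
  have hσ1 : σ = 1 := by
    rcases hσ with h | rfl
    · exact h
    · have := mul_pos hQ hB
      have := mul_nonneg hP.le hA
      linarith
  rw [hσ1, one_mul] at hrel
  have hPQ : IsCoprime (r * a ^ x) (s * b ^ min y y') := by
    have h1 := hco.of_mul_left_left
    have h2 := hco.of_mul_left_right
    exact IsCoprime.mul_left
      (h1.of_mul_right_left.mul_right (h1.of_mul_right_right.pow_right))
      ((h2.of_mul_right_left.mul_right (h2.of_mul_right_right.pow_right)).pow_left)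
  obtain ⟨t, ht⟩ := hPQ.dvd_of_dvd_mul_left (Dvd.intro _ hrel)
  refine ⟨_, _, t, hββ, hαα, pos_of_mul_pos_right (ht ▸ hB) hP.le, ht, ?_⟩
  rw [ht] at hrel
  exact mul_left_cancel₀ hP.ne' (by linarith)

/-- The coefficient of `b` is small compared to the gap between the exponents of `a`. -/
theorem IsSol.mul_le_pow_add_one {a b c r s : ℤ} (ha : 1 < a)
    (hco : IsCoprime (r * a) (s * b)) {x y x' y' : ℕ} (h : IsSol a b c r s x y)
    (h' : IsSol a b c r s x' y') (hx : x < x') : s * b ≤ a ^ (x' - x) + 1 := by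
  obtain ⟨α, β, hα, hβ, e⟩ := h.exists_signs
  obtain ⟨α', β', hα', hβ', e'⟩ := h'.exists_signs
  obtain ⟨n, rfl⟩ := Nat.exists_eq_add_of_le hx.le
  rw [Nat.add_sub_cancel_left]
  obtain ⟨m, rfl⟩ : ∃ m, y = m + 1 := ⟨y - 1, by have := h.2.1; omega⟩
  obtain ⟨m', rfl⟩ : ∃ m, y' = m + 1 := ⟨y' - 1, by have := h'.2.1; omega⟩
  have hdvd : s * b ∣ r * a ^ x * (a ^ n - α * α') := by
    have hα2 : α' * α' = 1 := by rcases hα' with rfl | rfl <;> norm_num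
    refine ⟨α' * (β * b ^ m - β' * b ^ m'), ?_⟩
    rw [pow_add] at e'
    linear_combination α' * e' - α' * e - r * a ^ x * a ^ n * hα2
  have hra : IsCoprime (r * a ^ x) (s * b) :=
    hco.of_mul_left_left.mul_left hco.of_mul_left_right.pow_left
  have hd := hra.symm.dvd_of_dvd_mul_left hdvd
  have hpow : 1 < a ^ n := one_lt_pow₀ ha (by omega)
  have hαα : α * α' = 1 ∨ α * α' = -1 := by
    rcases hα with rfl | rfl <;> rcases hα' with rfl | rfl <;> simp
  rcases hαα with h | h <;> rw [h] at hd <;> have := Int.le_of_dvd (by linarith) hd <;> linarith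

/-- For three solutions sorted by `x`, the gap `x₂ - x₁` in powers of `a` forces divisibility of
the gap between `y₂` and `y₃`. -/
theorem IsSol.dvd_dist {a b c r s : ℤ} (ha : 1 < a) (hb : 1 < b) (hr : 0 < r) (hs : 0 < s)
    (hco : IsCoprime (r * a) (s * b)) {x₁ y₁ x₂ y₂ x₃ y₃ : ℕ} (h₁ : IsSol a b c r s x₁ y₁)
    (h₂ : IsSol a b c r s x₂ y₂) (h₃ : IsSol a b c r s x₃ y₃) (hx : x₁ < x₂) (hx' : x₂ ≤ x₃)
    (hy : y₁ ≠ y₂) (hy' : y₂ ≠ y₃) {K : ℕ} (hK : (K : ℤ) ∣ a ^ (x₂ - x₁))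
    (h4 : 2 ∣ K → 4 ∣ r * a ^ x₁) (hM2 : r * a ^ x₁ ≠ 2) : K ∣ Nat.dist y₂ y₃ := by
  obtain ⟨ε, ε', t, hε, hε', -, hd, ht⟩ := h₁.exists_factor ha hb hr hs hco h₂ hx.le hy
  obtain ⟨η, -, t', hη, -, -, he, -⟩ := h₂.exists_factor ha hb hr hs hco h₃ hx' hy'
  have hx1 : x₁ ≠ 0 := h₁.1.ne'
  obtain ⟨n, rfl⟩ := Nat.exists_eq_add_of_le hx.le
  rw [Nat.add_sub_cancel_left] at hK ht
  have hn : n ≠ 0 := by omega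
  set M := r * a ^ x₁ with hMdef
  have hM : 2 < M := by
    have h1 : a ≤ a ^ x₁ := le_self_pow₀ ha.le hx1
    have h2 : a ^ x₁ ≤ r * a ^ x₁ := le_mul_of_one_le_left (by positivity) hr
    omega
  have hbM : IsCoprime b M :=
    (hco.of_mul_left_left.mul_left hco.of_mul_left_right.pow_left).symm.of_mul_left_right
  have haM : a ∣ M := (dvd_pow_self a hx1).mul_left r
  obtain ⟨δ, hδ, T, hT⟩ := exists_dvd_pow_gcd_sub_sign hbM hε hη (Dvd.intro _ hd.symm)
    (show M ∣ b ^ Nat.dist y₂ y₃ - η from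
      ⟨a ^ n * t', by rw [he, hMdef, pow_add]; ring⟩)
  have hδpow : ∀ m : ℕ, δ ^ m = 1 ∨ δ ^ m = -1 := fun m => by
    rcases hδ with rfl | rfl
    · simp
    · exact neg_one_pow_eq_or ℤ m
  have hsign : ∀ θ θ' : ℤ, (θ = 1 ∨ θ = -1) → (θ' = 1 ∨ θ' = -1) → M ∣ θ - θ' → θ = θ' := by
    rintro _ _ (rfl | rfl) (rfl | rfl) hdvd
    · rfl
    · have := Int.le_of_dvd (by norm_num) hdvd; omega
    · have := Int.le_of_dvd (by norm_num) ((dvd_neg).mpr hdvd); omega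
    · rfl
  set g := Nat.gcd (Nat.dist y₁ y₂) (Nat.dist y₂ y₃)
  obtain ⟨j, hj⟩ : g ∣ Nat.dist y₁ y₂ := Nat.gcd_dvd_left _ _
  obtain ⟨m, hm⟩ : g ∣ Nat.dist y₂ y₃ := Nat.gcd_dvd_right _ _
  have hdj : M * T ∣ b ^ Nat.dist y₁ y₂ - δ ^ j := by
    rw [hj, pow_mul, ← hT]; exact sub_dvd_pow_sub_pow _ _ j
  have hem : M * T ∣ b ^ Nat.dist y₂ y₃ - δ ^ m := by
    rw [hm, pow_mul, ← hT]; exact sub_dvd_pow_sub_pow _ _ m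
  have hεj : ε = δ ^ j := hsign _ _ hε (hδpow j) (by
    have h1 := dvd_of_mul_right_dvd hdj
    have h2 : M ∣ b ^ Nat.dist y₁ y₂ - ε := Dvd.intro _ hd.symm
    simpa using dvd_sub h1 h2)
  have hηm : η = δ ^ m := hsign _ _ hη (hδpow m) (by
    have h1 := dvd_of_mul_right_dvd hem
    have h2 : M ∣ b ^ Nat.dist y₂ y₃ - η := ⟨a ^ n * t', by rw [he, hMdef, pow_add]; ring⟩
    simpa using dvd_sub h1 h2)
  have hTt : T ∣ t := by
    rw [← hεj, hd] at hdj
    exact Int.dvd_of_mul_dvd_mul_left (by omega) hdj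
  have hprime : ∀ p : ℕ, p.Prime → p ∣ K → (p : ℤ) ∣ a := fun p hp hpK =>
    (Nat.prime_iff_prime_int.mp hp).dvd_of_dvd_pow ((Int.natCast_dvd_natCast.mpr hpK).trans hK)
  have hKm : K ∣ m := by
    refine dvd_of_mul_dvd_pow_sub_pow (M := M) (X := b ^ g) (δ := δ) (T := T) (by omega) hδ hT
      (fun p hp hpK => (hprime p hp hpK).trans haM) ?_ h4 ?_
    · intro p hp hpK hpT
      have hpp := Nat.prime_iff_prime_int.mp hp
      have h1 : (p : ℤ) ∣ a ^ n - ε' := by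
        rw [ht]; exact (hpT.trans hTt).mul_left _
      have h2 : (p : ℤ) ∣ ε' :=
        (dvd_sub_right (dvd_pow (hprime p hp hpK) hn)).mp h1
      exact hpp.not_isUnit (isUnit_of_dvd_unit h2 (Int.isUnit_iff.mpr hε'))
    · rw [← pow_mul, ← hm, ← hηm, he, pow_add, ← mul_assoc r, mul_comm (K : ℤ)]
      exact (mul_dvd_mul_left M hK).mul_right t'
  exact hKm.trans ⟨g, by rw [hm, mul_comm]⟩

/-- If `r * a` is odd, the bases are bounded by the exponents of `b`. -/
theorem IsSol.bases_le {a b c r s : ℤ} (ha : 1 < a) (hb : 1 < b) (hr : 0 < r) (hs : 0 < s)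
    (hco : IsCoprime (r * a) (s * b)) {x₁ y₁ x₂ y₂ x₃ y₃ : ℕ} (h₁ : IsSol a b c r s x₁ y₁)
    (h₂ : IsSol a b c r s x₂ y₂) (h₃ : IsSol a b c r s x₃ y₃) (hx : x₁ < x₂) (hx' : x₂ ≤ x₃)
    (hy : y₁ ≠ y₂) (hy' : y₂ ≠ y₃) (ho : Odd (r * a)) {N : ℤ} (hN₂ : y₂ ≤ N) (hN₃ : y₃ ≤ N) :
    a ≤ N ∧ b ≤ N := by
  have hle := h₁.mul_le_pow_add_one ha hco h₂ hx
  have hao : Odd (r * a ^ x₁) := by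
    rw [Int.odd_mul] at ho ⊢
    exact ⟨ho.1, ho.2.pow⟩
  have hao' : Odd a := (Int.odd_mul.mp ho).2
  have hdvd : (a ^ (x₂ - x₁)).natAbs ∣ Nat.dist y₂ y₃ := by
    refine h₁.dvd_dist ha hb hr hs hco h₂ h₃ hx hx' hy hy' (Int.natAbs_dvd.mpr dvd_rfl) ?_ ?_
    · intro h
      have h1 : Odd (a ^ (x₂ - x₁)) := hao'.pow
      rw [← Int.natAbs_odd] at h1
      exact absurd (even_iff_two_dvd.mpr h) (Nat.not_even_iff_odd.mpr h1)
    · intro h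
      rw [h] at hao
      exact absurd hao (by decide)
  have hy2 := h₂.2.1
  have hy3 := h₃.2.1
  have hpos : 0 < Nat.dist y₂ y₃ := Nat.dist_pos_of_ne hy'
  have hK := Int.ofNat_le.mpr (Nat.le_of_dvd hpos hdvd)
  rw [Int.natCast_natAbs] at hK
  have hK' := (le_abs_self _).trans hK
  have hself : a ≤ a ^ (x₂ - x₁) := le_self_pow₀ ha.le (by omega)
  have hsb : b ≤ s * b := le_mul_of_one_le_left (by omega) hs
  have hd : (Nat.dist y₂ y₃ : ℤ) + 1 ≤ N := by
    have : Nat.dist y₂ y₃ + 1 ≤ max y₂ y₃ := by unfold Nat.dist; omega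
    omega
  constructor <;> linarith

/-- The coefficient of `b` is bounded by the exponents of `b`. -/
theorem IsSol.coeff_le {a b c r s : ℤ} (ha : 1 < a) (hb : 1 < b) (hr : 0 < r) (hs : 0 < s)
    (hco : IsCoprime (r * a) (s * b)) {x₁ y₁ x₂ y₂ x₃ y₃ : ℕ} (h₁ : IsSol a b c r s x₁ y₁)
    (h₂ : IsSol a b c r s x₂ y₂) (h₃ : IsSol a b c r s x₃ y₃) (hx : x₁ < x₂) (hx' : x₂ ≤ x₃)
    (hy : y₁ ≠ y₂ ∨ r * a ^ x₁ = 2) (hy' : y₂ ≠ y₃) {N : ℤ} (hN₂ : y₂ ≤ N) (hN₃ : y₃ ≤ N) :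
    s ≤ N := by
  have hle := h₁.mul_le_pow_add_one ha hco h₂ hx
  have hy2 := h₂.2.1
  have hy3 := h₃.2.1
  have hx1 : x₁ ≠ 0 := h₁.1.ne'
  have hpos : 0 < Nat.dist y₂ y₃ := Nat.dist_pos_of_ne hy'
  have hd : (Nat.dist y₂ y₃ : ℤ) + 1 ≤ N := by
    have : Nat.dist y₂ y₃ + 1 ≤ max y₂ y₃ := by unfold Nat.dist; omega
    omega
  suffices hmain : 2 * a ^ (x₂ - x₁) ≤ (b + 1) * Nat.dist y₂ y₃ by
    by_contra! hlt
    nlinarith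
  have haM : a ≤ r * a ^ x₁ :=
    (le_self_pow₀ ha.le hx1).trans (le_mul_of_one_le_left (by positivity) hr)
  by_cases hcase : Even a ∧ ¬ 4 ∣ r * a ^ x₁
  · obtain ⟨⟨a', rfl⟩, h4⟩ := hcase
    have hx1' : x₁ = 1 := by
      by_contra hne
      obtain ⟨k, rfl⟩ : ∃ k, x₁ = 2 + k := ⟨x₁ - 2, by omega⟩
      exact h4 ⟨r * a' ^ 2 * (a' + a') ^ k, by rw [pow_add]; ring⟩
    subst hx1'
    rw [pow_one] at *
    have ha'o : Odd a' := by
      rw [← Int.not_even_iff_odd]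
      rintro ⟨k, rfl⟩
      exact h4 ⟨r * k, by ring⟩
    have hbo : Odd b := by
      have h1 := hco.of_mul_left_right.of_mul_right_right
      rw [← Int.not_even_iff_odd]
      rintro ⟨k, rfl⟩
      have : (2 : ℤ) ∣ 1 := by
        rw [← isUnit_iff_dvd_one]
        exact h1.isUnit_of_dvd' ⟨a', by ring⟩ ⟨k, by ring⟩
      omega
    have hKdvd : (a' ^ (x₂ - 1)).natAbs ∣ Nat.dist y₂ y₃ := by
      by_cases hM : r * (a' + a') = 2
      · have : a' = 1 := by nlinarith
        simp [this]
      · refine h₁.dvd_dist ha hb hr hs hco h₂ h₃ hx hx' (hy.resolve_right hM) hy' ?_ ?_ (by simpa)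
        · rw [Int.natAbs_dvd]
          exact pow_dvd_pow_of_dvd ⟨2, by ring⟩ _
        · intro h
          have h1 : Odd (a' ^ (x₂ - 1)) := ha'o.pow
          rw [← Int.natAbs_odd] at h1
          exact absurd (even_iff_two_dvd.mpr h) (Nat.not_even_iff_odd.mpr h1)
    obtain ⟨η, -, t', hη, -, -, he, -⟩ := h₂.exists_factor ha hb hr hs hco h₃ hx' hy'
    obtain ⟨h, n, hn, hhn⟩ := Nat.exists_eq_two_pow_mul_odd hpos.ne'
    have h2 : (2 : ℤ) ^ x₂ ≤ (b + 1) * 2 ^ h := by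
      refine two_pow_le_of_dvd_pow_sub_sign hb hbo hη hn h x₂ hx ?_
      rw [← hhn, he]
      exact ⟨r * a' ^ x₂ * t', by rw [← two_mul, mul_pow]; ring⟩
    have hcop : Nat.Coprime (2 ^ h) (a' ^ (x₂ - 1)).natAbs := by
      apply Nat.Coprime.pow_left
      rw [Nat.coprime_two_left, Int.natAbs_odd]
      exact ha'o.pow
    have hprod := Nat.le_of_dvd hpos
      (hcop.mul_dvd_of_dvd_of_dvd ⟨n, hhn⟩ hKdvd)
    have ha'pos : 0 < a' := by omega
    have hprod' : (2 : ℤ) ^ h * a' ^ (x₂ - 1) ≤ Nat.dist y₂ y₃ := by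
      have := Int.ofNat_le.mpr hprod
      rw [Nat.cast_mul, Int.natCast_natAbs, abs_of_pos (by positivity)] at this
      exact_mod_cast this
    calc 2 * (a' + a') ^ (x₂ - 1) = 2 ^ x₂ * a' ^ (x₂ - 1) := by
          obtain ⟨k, rfl⟩ : ∃ k, x₂ = k + 1 := ⟨x₂ - 1, by omega⟩
          rw [← two_mul, mul_pow, Nat.add_sub_cancel, pow_succ]; ring
      _ ≤ (b + 1) * 2 ^ h * a' ^ (x₂ - 1) := by gcongr
      _ = (b + 1) * (2 ^ h * a' ^ (x₂ - 1)) := by ring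
      _ ≤ _ := by gcongr
  · have hM : r * a ^ x₁ ≠ 2 := by
      intro h
      have : a = 2 := by omega
      exact hcase ⟨by rw [this]; decide, by rw [h]; decide⟩
    have hdvd : (a ^ (x₂ - x₁)).natAbs ∣ Nat.dist y₂ y₃ := by
      refine h₁.dvd_dist ha hb hr hs hco h₂ h₃ hx hx' (hy.resolve_right hM) hy'
        (Int.natAbs_dvd.mpr dvd_rfl) ?_ hM
      intro h
      by_contra h4
      refine hcase ⟨?_, h4⟩
      rw [← even_iff_two_dvd, Int.natAbs_even] at h
      exact (Int.even_pow.mp h).1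
    have hK := Int.ofNat_le.mpr (Nat.le_of_dvd hpos hdvd)
    rw [Int.natCast_natAbs] at hK
    have hK' := (le_abs_self _).trans hK
    nlinarith

/-- Two solutions with the same `x` force `s = 1`, `b = 2` and `y = 1`. -/
theorem IsSol.eq_of_same_fst {a b c r s : ℤ} (ha : 1 < a) (hb : 1 < b) (hr : 0 < r) (hs : 0 < s)
    (hco : IsCoprime (r * a) (s * b)) {x y y' : ℕ} (h : IsSol a b c r s x y)
    (h' : IsSol a b c r s x y') (hy : y < y') :
    s = 1 ∧ b = 2 ∧ y = 1 ∧ ∃ σ : ℤ, (σ = 1 ∨ σ = -1) ∧ 2 ^ (y' - 1) - σ = r * a ^ x := by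
  obtain ⟨σ, ε', t, hσ, hε', ht0, hd, ht⟩ := h.exists_factor ha hb hr hs hco h' le_rfl hy.ne
  rw [Nat.sub_self, pow_zero, min_eq_left hy.le] at ht
  obtain ⟨m, rfl⟩ : ∃ m, y = m + 1 := ⟨y - 1, by have := h.2.1; omega⟩
  have hbm : 1 ≤ b ^ m := one_le_pow₀ hb.le
  have hle : s * b ^ (m + 1) * t ≤ 2 := by rcases hε' with rfl | rfl <;> omega
  have hsb : b ≤ s * b ^ (m + 1) := by
    rw [pow_succ]
    nlinarith [mul_le_mul (show 1 ≤ s from hs) hbm (by norm_num) hs.le]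
  have ht1 : t = 1 := by nlinarith
  subst ht1
  have hb2 : b = 2 := by nlinarith
  subst hb2
  have hs2 : s * 2 ^ (m + 1) = 2 := by omega
  have hm : m = 0 := by
    by_contra hm
    have : (2 : ℤ) ≤ 2 ^ m := le_self_pow₀ (by norm_num) hm
    rw [pow_succ] at hs2
    nlinarith
  subst hm
  refine ⟨by omega, rfl, rfl, σ, hσ, ?_⟩
  rw [Nat.dist_eq_sub_of_le hy.le] at hd
  linarith

/-- The binomial expansion of `(M + σ) ^ j` modulo `M ^ 2` for a sign `σ`. -/
theorem exists_add_sign_pow_eq {M σ : ℤ} (hσ : σ = 1 ∨ σ = -1) (j : ℕ) :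
    ∃ q : ℤ, (M + σ) ^ j = σ ^ j * (1 + j * M * σ) + M ^ 2 * q := by
  have h2 : σ * σ = 1 := by rcases hσ with rfl | rfl <;> norm_num
  induction j with
  | zero => exact ⟨0, by simp⟩
  | succ j ih =>
    obtain ⟨q, hq⟩ := ih
    refine ⟨q * (M + σ) + σ ^ j * j * σ, ?_⟩
    rw [pow_succ, hq, pow_succ]
    push_cast
    linear_combination (-σ ^ j * M) * h2

/-- The bound on `a` when the smallest value of `x` is attained twice. -/
theorem IsSol.base_le_of_same_fst {a c r : ℤ} (ha : 1 < a) (hr : 0 < r)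
    (hco : IsCoprime (r * a) (1 * 2)) {x y₂ x₃ y₃ : ℕ} (h₁ : IsSol a 2 c r 1 x 1)
    (h₃ : IsSol a 2 c r 1 x₃ y₃) (hy₂ : 1 < y₂) (hx : x < x₃) (hy₃ : 1 < y₃) (hy : y₂ ≠ y₃)
    {σ : ℤ} (hσ : σ = 1 ∨ σ = -1) (hM : 2 ^ (y₂ - 1) - σ = r * a ^ x)
    {N : ℤ} (hN₂ : y₂ ≤ N) (hN₃ : y₃ ≤ N) : a ≤ N := by
  obtain ⟨ε, ε', t, hε, hε', -, hd, ht⟩ :=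
    h₁.exists_factor ha (by norm_num) hr (by norm_num) hco h₃ hx.le hy₃.ne
  rw [min_eq_left hy₃.le, pow_one, one_mul] at ht
  rw [Nat.dist_eq_sub_of_le hy₃.le] at hd
  obtain ⟨d, rfl⟩ : ∃ d, y₂ = d + 1 := ⟨y₂ - 1, by omega⟩
  obtain ⟨f, rfl⟩ : ∃ f, y₃ = f + 1 := ⟨y₃ - 1, by omega⟩
  rw [Nat.add_sub_cancel] at hM hd
  push_cast at hN₂ hN₃
  set M := r * a ^ x
  have hx0 : x ≠ 0 := h₁.1.ne'
  have haM : a ∣ M := (dvd_pow_self a hx0).mul_left r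
  have hMpos : 0 < M := by positivity
  have haM' : a ≤ M := Int.le_of_dvd hMpos haM
  have ha3 : 3 ≤ a := by
    by_contra hlt
    have h2 : a = 2 := by omega
    rw [h2] at hco
    have := hco.of_mul_left_right.of_mul_right_right
    rw [isCoprime_self, Int.isUnit_iff] at this
    omega
  rcases (show d = 1 ∨ 2 ≤ d by omega) with rfl | hd2
  · rcases hσ with rfl | rfl <;> omega
  have hbM : IsCoprime (2 : ℤ) M :=
    (hco.of_mul_left_left.mul_left hco.of_mul_left_right.pow_left).symm.of_mul_left_right
  obtain ⟨δ, hδ, hdvd⟩ := exists_dvd_pow_gcd_sub_sign hbM hσ hε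
    (dvd_of_eq hM.symm) (Dvd.intro _ hd.symm)
  obtain ⟨k, hk⟩ := Nat.gcd_dvd_left d f
  set g := Nat.gcd d f
  have hg : g ≠ 0 := by rintro h; rw [h, zero_mul] at hk; omega
  have hg2 : (2 : ℤ) ≤ 2 ^ g := le_self_pow₀ (by norm_num) hg
  rcases (show k = 0 ∨ k = 1 ∨ 2 ≤ k by omega) with rfl | rfl | hk2
  · omega
  · obtain ⟨j, hj⟩ : d ∣ f := by
      have := Nat.gcd_dvd_right d f
      rwa [show Nat.gcd d f = d by omega] at this
    obtain ⟨q, hq⟩ := exists_add_sign_pow_eq (M := M) hσ j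
    rw [show M + σ = 2 ^ d by omega, ← pow_mul, ← hj] at hq
    have hσj := (neg_one_pow_eq_or ℤ j)
    have hσpow : σ ^ j = 1 ∨ σ ^ j = -1 := by
      rcases hσ with rfl | rfl
      · simp
      · exact hσj
    have hεσ : M ∣ σ ^ j - ε := ⟨t - σ ^ j * j * σ - M * q, by linear_combination hd - hq⟩
    have hεσ' : σ ^ j = ε := by
      rcases hσpow with h | h <;> rcases hε with rfl | rfl <;> rw [h] at hεσ ⊢
      · have := Int.le_of_dvd (by norm_num) hεσ; omega
      · have := Int.le_of_dvd (by norm_num) ((dvd_neg).mpr hεσ); omega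
    have htq : t = σ ^ j * σ * j + M * q := by
      apply mul_left_cancel₀ hMpos.ne'
      linear_combination hq - hd + hεσ'
    have hdiv : a ∣ 2 * (σ ^ j * σ * j) + ε' := by
      have h1 : a ∣ a ^ (x₃ - x) := dvd_pow_self a (by omega)
      have h2 : 2 * (σ ^ j * σ * j) + ε' = a ^ (x₃ - x) - M * (2 * q) := by
        rw [htq] at ht; linear_combination -ht
      rw [h2]
      exact dvd_sub h1 (haM.mul_right _)
    have hj0 : j ≠ 0 := by rintro rfl; omega
    have hfin : a ≤ 2 * j + 1 := by
      have hs : σ ^ j * σ = 1 ∨ σ ^ j * σ = -1 := by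
        rcases hσpow with h | h <;> rcases hσ with rfl | rfl <;> simp [h]
      rcases hs with h | h <;> rw [h] at hdiv
      · have := Int.le_of_dvd (by rcases hε' with rfl | rfl <;> omega) hdiv
        rcases hε' with rfl | rfl <;> omega
      · have := Int.le_of_dvd (by rcases hε' with rfl | rfl <;> omega) ((dvd_neg).mpr hdiv)
        rcases hε' with rfl | rfl <;> omega
    have : 2 * j ≤ f := hj ▸ Nat.mul_le_mul_right j hd2
    omega
  · have hgd : (2 : ℤ) ^ g * 2 ^ g ≤ 2 ^ d := by
      rw [← pow_add]
      exact pow_le_pow_right₀ (by norm_num) (by rw [hk]; nlinarith)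
    have hMg : M ≤ 2 ^ g + 1 := by
      rcases hδ with rfl | rfl
      · have := Int.le_of_dvd (by omega) hdvd; omega
      · have := Int.le_of_dvd (by omega) hdvd; omega
    have hMd : (2 : ℤ) ^ d - 1 ≤ M := by rcases hσ with rfl | rfl <;> omega
    have : (2 : ℤ) ^ g ≤ 2 := by nlinarith
    omega

/-- The claimed bound when two of the solutions share their `x`. -/
theorem IsSol.le_of_same_fst {a b c r s : ℤ} (ha : 1 < a) (hb : 1 < b) (hr : 0 < r) (hs : 0 < s)
    (hco : IsCoprime (r * a) (s * b)) {x y₁ y₂ x₃ y₃ : ℕ} (h₁ : IsSol a b c r s x y₁)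
    (h₂ : IsSol a b c r s x y₂) (h₃ : IsSol a b c r s x₃ y₃) (h12 : y₁ ≠ y₂)
    (h13 : (x, y₁) ≠ (x₃, y₃)) (h23 : (x, y₂) ≠ (x₃, y₃)) {N : ℤ} (hNx : x ≤ N) (hN₁ : y₁ ≤ N)
    (hN₂ : y₂ ≤ N) (hNx₃ : x₃ ≤ N) (hN₃ : y₃ ≤ N) : r ≤ N ∧ s ≤ N ∧ a ≤ N ∧ b ≤ N := by
  wlog hlt : y₁ < y₂ generalizing y₁ y₂
  · exact this h₂ h₁ h12.symm h23 h13 hN₂ hN₁ (by omega)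
  obtain ⟨rfl, rfl, rfl, σ, hσ, hM⟩ := h₁.eq_of_same_fst ha hb hr hs hco h₂ hlt
  have ha2 : a ≠ 2 := by
    rintro rfl
    have := hco.of_mul_left_right.of_mul_right_right
    rw [isCoprime_self, Int.isUnit_iff] at this
    omega
  have hsnd : ∀ {y : ℕ}, IsSol a 2 c r 1 x y → (x, y) ≠ (x₃, y₃) → y ≠ y₃ := by
    rintro y h hne rfl
    rcases lt_trichotomy x x₃ with hx | rfl | hx
    · exact ha2 (h.swap.eq_of_same_fst hb ha hs hr hco.symm h₃.swap hx).2.1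
    · exact hne rfl
    · exact ha2 (h₃.swap.eq_of_same_fst hb ha hs hr hco.symm h.swap hx).2.1
  have hy13 := hsnd h₁ h13
  have hy23 := hsnd h₂ h23
  have hy3 := h₃.2.1
  have hx : x ≠ x₃ := by
    rintro rfl
    rcases lt_or_gt_of_ne hy23 with h | h
    · have := (h₂.eq_of_same_fst ha hb hr hs hco h₃ h).2.2.1; omega
    · have := (h₃.eq_of_same_fst ha hb hr hs hco h₂ h).2.2.1; omega
  refine ⟨?_, by omega, ?_, by omega⟩
  · rcases lt_or_gt_of_ne hy23 with h | h
    · exact h₁.swap.coeff_le hb ha hs hr hco.symm h₂.swap h₃.swap hlt h.le (by simp) hx hNx hNx₃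
    · exact h₁.swap.coeff_le hb ha hs hr hco.symm h₃.swap h₂.swap (by omega) h.le (by simp)
        hx.symm hNx₃ hNx
  · rcases lt_or_gt_of_ne hx with h | h
    · exact h₁.base_le_of_same_fst ha hr hco h₃ hlt h (by omega) hy23 hσ hM hN₂ hN₃
    · refine (h₃.bases_le ha hb hr hs hco h₁ h₂ h le_rfl hy13.symm hlt.ne ?_ hN₁ hN₂).1
      rw [← Int.not_even_iff_odd]
      intro he
      have := Int.isUnit_iff.mp
        (hco.of_mul_right_right.isUnit_of_dvd' (even_iff_two_dvd.mp he) dvd_rfl)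
      omega

/-- The bounds in terms of the exponents of `b`, for solutions with distinct exponents. -/
theorem IsSol.le_of_ne {a b c r s : ℤ} (ha : 1 < a) (hb : 1 < b) (hr : 0 < r) (hs : 0 < s)
    (hco : IsCoprime (r * a) (s * b)) {x₁ y₁ x₂ y₂ x₃ y₃ : ℕ} (h₁ : IsSol a b c r s x₁ y₁)
    (h₂ : IsSol a b c r s x₂ y₂) (h₃ : IsSol a b c r s x₃ y₃) (hx12 : x₁ ≠ x₂) (hx13 : x₁ ≠ x₃)
    (hx23 : x₂ ≠ x₃) (hy12 : y₁ ≠ y₂) (hy13 : y₁ ≠ y₃) (hy23 : y₂ ≠ y₃) {N : ℤ} (hN₁ : y₁ ≤ N)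
    (hN₂ : y₂ ≤ N) (hN₃ : y₃ ≤ N) : s ≤ N ∧ (Odd (r * a) → a ≤ N ∧ b ≤ N) := by
  have sorted : ∀ {x₁ y₁ x₂ y₂ x₃ y₃ : ℕ}, IsSol a b c r s x₁ y₁ → IsSol a b c r s x₂ y₂ →
      IsSol a b c r s x₃ y₃ → x₁ < x₂ → x₂ < x₃ → y₁ ≠ y₂ → y₂ ≠ y₃ → (y₂ : ℤ) ≤ N →
      (y₃ : ℤ) ≤ N → s ≤ N ∧ (Odd (r * a) → a ≤ N ∧ b ≤ N) :=
    fun h₁ h₂ h₃ hx hx' hy hy' hN hN' =>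
      ⟨h₁.coeff_le ha hb hr hs hco h₂ h₃ hx hx'.le (.inl hy) hy' hN hN',
        fun ho => h₁.bases_le ha hb hr hs hco h₂ h₃ hx hx'.le hy hy' ho hN hN'⟩
  rcases lt_or_gt_of_ne hx12 with h | h <;> rcases lt_or_gt_of_ne hx13 with h' | h' <;>
    rcases lt_or_gt_of_ne hx23 with h'' | h''
  · exact sorted h₁ h₂ h₃ h h'' hy12 hy23 hN₂ hN₃
  · exact sorted h₁ h₃ h₂ h' h'' hy13 hy23.symm hN₃ hN₂
  · omega
  · exact sorted h₃ h₁ h₂ h' h hy13.symm hy12 hN₁ hN₂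
  · exact sorted h₂ h₁ h₃ h h' hy12.symm hy13 hN₁ hN₃
  · omega
  · exact sorted h₂ h₃ h₁ h'' h' hy23 hy13.symm hN₃ hN₁
  · exact sorted h₃ h₂ h₁ h'' h hy23.symm hy12.symm hN₂ hN₁

theorem stmt_6 (a b c r s : ℤ)
    (ha : 1 < a) (hb : 1 < b) (hc : 0 < c) (hr : 0 < r) (hs : 0 < s)
    (hgcd : Int.gcd (r * a) (s * b) = 1)
    (x₁ y₁ x₂ y₂ x₃ y₃ : ℕ)
    (h1 : IsSol a b c r s x₁ y₁) (h2 : IsSol a b c r s x₂ y₂)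
    (h3 : IsSol a b c r s x₃ y₃)
    (h12 : (x₁, y₁) ≠ (x₂, y₂)) (h13 : (x₁, y₁) ≠ (x₃, y₃))
    (h23 : (x₂, y₂) ≠ (x₃, y₃)) :
    (max (max (max x₁ y₁) (max x₂ y₂)) (max x₃ y₃) : ℤ) ≥
      max (max r s) (max a b) := by
  have hco : IsCoprime (r * a) (s * b) := Int.isCoprime_iff_gcd_eq_one.mpr hgcd
  obtain ⟨N, hN⟩ : ∃ N : ℤ, (max (max (max x₁ y₁) (max x₂ y₂)) (max x₃ y₃) : ℤ) = N := ⟨_, rfl⟩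
  have hx₁ : (x₁ : ℤ) ≤ N := by omega
  have hx₂ : (x₂ : ℤ) ≤ N := by omega
  have hx₃ : (x₃ : ℤ) ≤ N := by omega
  have hy₁ : (y₁ : ℤ) ≤ N := by omega
  have hy₂ : (y₂ : ℤ) ≤ N := by omega
  have hy₃ : (y₃ : ℤ) ≤ N := by omega
  rw [hN]
  suffices r ≤ N ∧ s ≤ N ∧ a ≤ N ∧ b ≤ N by omega
  clear hN
  have fst : ∀ {x y₁ y₂ x₃ y₃ : ℕ}, IsSol a b c r s x y₁ → IsSol a b c r s x y₂ →
      IsSol a b c r s x₃ y₃ → (x, y₁) ≠ (x, y₂) → (x, y₁) ≠ (x₃, y₃) → (x, y₂) ≠ (x₃, y₃) →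
      (x : ℤ) ≤ N → (y₁ : ℤ) ≤ N → (y₂ : ℤ) ≤ N → (x₃ : ℤ) ≤ N → (y₃ : ℤ) ≤ N →
      r ≤ N ∧ s ≤ N ∧ a ≤ N ∧ b ≤ N := fun k₁ k₂ k₃ n12 n13 n23 =>
    k₁.le_of_same_fst ha hb hr hs hco k₂ k₃ (by simpa using n12) n13 n23
  have snd : ∀ {x₁ x₂ y x₃ y₃ : ℕ}, IsSol a b c r s x₁ y → IsSol a b c r s x₂ y →
      IsSol a b c r s x₃ y₃ → (x₁, y) ≠ (x₂, y) → (x₁, y) ≠ (x₃, y₃) → (x₂, y) ≠ (x₃, y₃) →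
      (x₁ : ℤ) ≤ N → (x₂ : ℤ) ≤ N → (y : ℤ) ≤ N → (x₃ : ℤ) ≤ N → (y₃ : ℤ) ≤ N →
      r ≤ N ∧ s ≤ N ∧ a ≤ N ∧ b ≤ N := by
    intro x₁ x₂ y x₃ y₃ k₁ k₂ k₃ n12 n13 n23 l₁ l₂ ly l₃ l₃'
    obtain ⟨p, q, p', q'⟩ := k₁.swap.le_of_same_fst hb ha hs hr hco.symm k₂.swap k₃.swap
      (by simpa using n12) (by simpa [and_comm] using n13) (by simpa [and_comm] using n23)
      ly l₁ l₂ l₃' l₃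
    exact ⟨q, p, q', p'⟩
  by_cases ex12 : x₁ = x₂
  · subst ex12; exact fst h1 h2 h3 h12 h13 h23 hx₁ hy₁ hy₂ hx₃ hy₃
  by_cases ex13 : x₁ = x₃
  · subst ex13; exact fst h1 h3 h2 h13 h12 h23.symm hx₁ hy₁ hy₃ hx₂ hy₂
  by_cases ex23 : x₂ = x₃
  · subst ex23; exact fst h2 h3 h1 h23 h12.symm h13.symm hx₂ hy₂ hy₃ hx₁ hy₁
  by_cases ey12 : y₁ = y₂
  · subst ey12; exact snd h1 h2 h3 h12 h13 h23 hx₁ hx₂ hy₁ hx₃ hy₃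
  by_cases ey13 : y₁ = y₃
  · subst ey13; exact snd h1 h3 h2 h13 h12 h23.symm hx₁ hx₃ hy₁ hx₂ hy₂
  by_cases ey23 : y₂ = y₃
  · subst ey23; exact snd h2 h3 h1 h23 h12.symm h13.symm hx₂ hx₃ hy₂ hx₁ hy₁
  obtain ⟨hsN, hab⟩ := h1.le_of_ne ha hb hr hs hco h2 h3 ex12 ex13 ex23 ey12 ey13 ey23 hy₁ hy₂ hy₃
  obtain ⟨hrN, hba⟩ := h1.swap.le_of_ne hb ha hs hr hco.symm h2.swap h3.swap ey12 ey13 ey23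
    ex12 ex13 ex23 hx₁ hx₂ hx₃
  rcases Int.even_or_odd (r * a) with he | ho
  · have ho : Odd (s * b) := by
      rw [← Int.not_even_iff_odd]
      intro he'
      have := Int.isUnit_iff.mp
        (hco.isUnit_of_dvd' (even_iff_two_dvd.mp he) (even_iff_two_dvd.mp he'))
      omega
    exact ⟨hrN, hsN, (hba ho).2, (hba ho).1⟩
  · exact ⟨hrN, hsN, hab ho⟩
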